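/- Let p be an odd prime and n a positive integer not divisible by p, and let K be the unramified extension of ℚ_p of degree n. Then for every continuous compactly supported function f : K → ℂ, ∫_K f(x) dx = p^{1−n} Σ_{ω ∈ μ_{q−1}} ∫_{Σ_n} ∫_{ℚ_p^{(1)}} f(ω ξ r) |r|_p^{n−1} dr dξ. -/

import Mathlib

open scoped Classical
noncomputable section

/-- The group `1 + pℤ_p` of principal units of `ℚ_p`. -/
def PUnits1 (p : ℕ) [Fact (Nat.Prime p)] : Set ℚ_[p] :=
  {u : ℚ_[p] | ‖u - 1‖ ≤ (p : ℝ)⁻¹}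

/-- The multiplicative subgroup `ℚ_p^{(1)} = p^ℤ · (1 + pℤ_p)` of `ℚ_p^*`. -/
def Qp1 (p : ℕ) [Fact (Nat.Prime p)] : Set ℚ_[p] :=
  {z : ℚ_[p] | ∃ ν : ℤ, ∃ u ∈ PUnits1 p, z = (p : ℚ_[p]) ^ ν * u}

/-- `ℚ_p^{(+)} = ℚ_p^{(1)} ∪ {0}`. -/
def QpPlus (p : ℕ) [Fact (Nat.Prime p)] : Set ℚ_[p] := Qp1 p ∪ {0}

/-- The ring of integers `O` of a normed field, i.e. the closed unit ball. -/
def ringO (K : Type) [NormedField K] : Set K := {x : K | ‖x‖ ≤ 1}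

/-- The group `U₁ = 1 + pO` of principal units of `K`. -/
def U1 (p : ℕ) (K : Type) [NormedField K] : Set K :=
  {x : K | ∃ y ∈ ringO K, x = 1 + (p : K) * y}

/-- The group `μ_{q-1}` of `(q-1)`-st roots of unity of `K`. -/
def muRoots (q : ℕ) (K : Type) [NormedField K] : Set K := {x : K | x ^ (q - 1) = 1}

/-- `ω : K → K` is a Teichmüller-component map: every `x ∈ K*` is uniquely
`x = p^ν · ω(x) · u` with `ω(x) ∈ μ_{q-1}` and `u ∈ U₁`. -/
def IsTeich (p q : ℕ) (K : Type) [NormedField K] (ω : K → K) : Prop :=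
  ∀ x : K, x ≠ 0 →
    (ω x ∈ muRoots q K ∧ ∃ ν : ℤ, ∃ u ∈ U1 p K, x = (p : K) ^ ν * (ω x * u)) ∧
    ∀ (w : K) (ν : ℤ) (u : K), w ∈ muRoots q K → u ∈ U1 p K →
      x = (p : K) ^ ν * (w * u) → w = ω x

/-- The compact group `Σ_n = {y ∈ K* : ω(y) = 1, N(y) = 1}`. -/
def SigmaN (p : ℕ) [Fact (Nat.Prime p)] (K : Type) [NormedField K] [Algebra ℚ_[p] K]
    (ω : K → K) : Set K :=
  {y : K | y ≠ 0 ∧ ω y = 1 ∧ Algebra.norm ℚ_[p] y = 1}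

/-- `r : K* → ℚ_p^{(1)}`, `r(x) = (N(ω(x)⁻¹ x))^{1/n}`, the radial part of the
spherical coordinates (characterized by `r(x) ∈ ℚ_p^{(1)}` and `r(x)^n = N(ω(x)⁻¹ x)`,
which determines it uniquely since `p ∤ n`). -/
def IsRadial (p n : ℕ) [Fact (Nat.Prime p)] (K : Type) [NormedField K] [Algebra ℚ_[p] K]
    (ω : K → K) (r : K → ℚ_[p]) : Prop :=
  ∀ x : K, x ≠ 0 → r x ∈ Qp1 p ∧ (r x) ^ n = Algebra.norm ℚ_[p] ((ω x)⁻¹ * x)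

/-- `K` is the unramified extension of `ℚ_p` of degree `n`: it has degree `n`,
its norm is the normalized absolute value `‖x‖ = |N(x)|_p`, and its value group
is `q^ℤ`, `q = p^n` (i.e. the extension is unramified). -/
def IsUnramifiedDeg (p n : ℕ) [Fact (Nat.Prime p)] (K : Type) [NormedField K]
    [Algebra ℚ_[p] K] : Prop :=
  Module.finrank ℚ_[p] K = n ∧
  (∀ x : K, ‖x‖ = ‖Algebra.norm ℚ_[p] x‖) ∧
  (∀ x : K, x ≠ 0 → ∃ m : ℤ, ‖x‖ = (p : ℝ) ^ ((n : ℤ) * m))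

open MeasureTheory

open scoped NNReal ENNReal Pointwise

section Scaling

variable {F : Type*} [NormedField F] [MeasurableSpace F] [BorelSpace F]

/-- Two measures on a field that do not charge `0`, scale by the absolute value under dilations,
and agree on a set `S` of elements of absolute value one closed under inversion are equal. -/
lemma measure_eq_of_dilation [SecondCountableTopology F] (μ ν : Measure F) [SFinite μ] [SFinite ν]
    (hμ0 : ∀ᵐ x ∂μ, x ≠ 0) (hν0 : ∀ᵐ x ∂ν, x ≠ 0)
    (hμ : ∀ a : F, a ≠ 0 → ∀ f : F → ℝ≥0∞, Measurable f →
      ‖a‖ₑ * ∫⁻ x, f (a * x) ∂μ = ∫⁻ x, f x ∂μ)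
    (hν : ∀ a : F, a ≠ 0 → ∀ f : F → ℝ≥0∞, Measurable f →
      ‖a‖ₑ * ∫⁻ x, f (a * x) ∂ν = ∫⁻ x, f x ∂ν)
    {S : Set F} (hS : MeasurableSet S) (hS1 : ∀ x ∈ S, ‖x‖ = 1) (hSinv : ∀ x ∈ S, x⁻¹ ∈ S)
    (hμν : μ S = ν S) (hS0 : ν S ≠ 0) (hS_lt : ν S ≠ ∞) : μ = ν := by
  have hSe : ∀ x ∈ S, ‖x‖ₑ = 1 := fun x hx => by
    rw [← ofReal_norm, hS1 x hx, ENNReal.ofReal_one]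
  have hinv : ∀ x, x⁻¹ ∈ S ↔ x ∈ S := fun x => ⟨fun h => by simpa using hSinv _ h, hSinv x⟩
  have hχ : Measurable (S.indicator (1 : F → ℝ≥0∞)) := measurable_one.indicator hS
  have he0 : ∀ a : F, a ≠ 0 → ‖a‖ₑ ≠ 0 := fun a ha => by simpa using ha
  set χ := S.indicator (1 : F → ℝ≥0∞) with hχdef
  have key : ∀ f : F → ℝ≥0∞, Measurable f → ν S * ∫⁻ x, f x ∂μ = μ S * ∫⁻ x, f x ∂ν := by
    intro f hf
    have hJ : ∀ x : F, x ≠ 0 → ∫⁻ y, χ (x * y⁻¹) * ‖y‖ₑ⁻¹ ∂ν = ν S := by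
      intro x hx
      rw [← hν x hx _ (by fun_prop), ← lintegral_const_mul _ (by fun_prop),
        ← lintegral_indicator_one hS]
      refine lintegral_congr fun y => ?_
      have h1 : x * (x * y)⁻¹ = y⁻¹ := by field_simp
      rw [h1, enorm_mul, ENNReal.mul_inv (Or.inl (he0 x hx)) (Or.inl enorm_ne_top)]
      by_cases hy : y ∈ S
      · have hy' := (hinv y).2 hy
        simp only [hχdef, Set.indicator_of_mem hy, Set.indicator_of_mem hy', Pi.one_apply, one_mul,
          hSe y hy, inv_one, mul_one]
        exact ENNReal.mul_inv_cancel (he0 x hx) enorm_ne_top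
      · have hy' := fun h => hy ((hinv y).1 h)
        simp [hχdef, Set.indicator_of_notMem hy, Set.indicator_of_notMem hy']
    have hL : ∀ y : F, y ≠ 0 →
        ∫⁻ x, f x * (χ (x * y⁻¹) * ‖y‖ₑ⁻¹) ∂μ = ∫⁻ x, f (y * x) * χ x ∂μ := by
      intro y hy
      rw [← hμ y hy _ (by fun_prop), ← lintegral_const_mul _ (by fun_prop)]
      refine lintegral_congr fun x => ?_
      have h1 : y * x * y⁻¹ = x := by field_simp
      rw [h1, mul_comm (χ x), ← mul_assoc, ← mul_assoc, mul_comm _ (f (y * x)), mul_assoc (f (y * x)),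
        ENNReal.mul_inv_cancel (he0 y hy) enorm_ne_top, mul_one]
    have hR : ∀ x : F, ∫⁻ y, f (y * x) * χ x ∂ν = χ x * ∫⁻ y, f y ∂ν := by
      intro x
      rw [lintegral_mul_const _ (by fun_prop), mul_comm]
      by_cases hx : x ∈ S
      · have hx0 : x ≠ 0 := fun h => by have := hS1 x hx; simp [h] at this
        have := hν x hx0 f hf
        rw [hSe x hx, one_mul] at this
        simp_rw [mul_comm _ x, this]
      · simp [hχdef, Set.indicator_of_notMem hx]
    calc ν S * ∫⁻ x, f x ∂μ = ∫⁻ x, f x * ν S ∂μ := by rw [lintegral_mul_const _ hf, mul_comm]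
      _ = ∫⁻ x, ∫⁻ y, f x * (χ (x * y⁻¹) * ‖y‖ₑ⁻¹) ∂ν ∂μ := by
        refine lintegral_congr_ae (hμ0.mono fun x hx => ?_)
        simp only
        rw [lintegral_const_mul _ (by fun_prop), hJ x hx]
      _ = ∫⁻ y, ∫⁻ x, f x * (χ (x * y⁻¹) * ‖y‖ₑ⁻¹) ∂μ ∂ν :=
        lintegral_lintegral_swap (by fun_prop)
      _ = ∫⁻ y, ∫⁻ x, f (y * x) * χ x ∂μ ∂ν := lintegral_congr_ae (hν0.mono fun y hy => hL y hy)
      _ = ∫⁻ x, ∫⁻ y, f (y * x) * χ x ∂ν ∂μ := lintegral_lintegral_swap (by fun_prop)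
      _ = μ S * ∫⁻ x, f x ∂ν := by
        simp_rw [hR]
        rw [lintegral_mul_const _ hχ, hχdef, lintegral_indicator_one hS]
  ext s hs
  have := key (s.indicator 1) (measurable_one.indicator hs)
  rw [lintegral_indicator_one hs, lintegral_indicator_one hs, hμν] at this
  exact (ENNReal.mul_right_inj hS0 hS_lt).1 this

variable [LocallyCompactSpace F]

lemma distribHaarChar_mul_lintegral [SecondCountableTopology F] (μ : Measure F) [μ.IsAddHaarMeasure] (u : Fˣ)
    {f : F → ℝ≥0∞} (hf : Measurable f) :
    distribHaarChar F u * ∫⁻ x, f (u * x) ∂μ = ∫⁻ x, f x ∂μ := by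
  have hu : Measurable fun x : F => (u : F) * x := by fun_prop
  have h : (distribHaarChar F u : ℝ≥0∞) • Measure.map (fun x : F => (u : F) * x) μ = μ := by
    ext s hs
    rw [Measure.smul_apply, Measure.map_apply hu hs, smul_eq_mul, distribHaarChar_mul]
    congr 1
    ext x
    rw [Set.mem_smul_set_iff_inv_smul_mem]
    simp [Units.smul_def]
  conv_rhs => rw [← h]
  rw [lintegral_smul_measure, lintegral_map hf hu, smul_eq_mul]

lemma distribHaarChar_of_norm_eq_one [SecondCountableTopology F] (μ : Measure F) [μ.IsAddHaarMeasure]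
    (hμ : μ (Metric.closedBall (0 : F) 1) ≠ ∞) (u : Fˣ) (hu : ‖(u : F)‖ = 1) :
    distribHaarChar F u = 1 := by
  refine distribHaarChar_eq_of_measure_smul_eq_mul (μ := μ)
    (Metric.measure_closedBall_pos μ 0 one_pos).ne' hμ ?_
  rw [ENNReal.coe_one, one_mul]
  congr 1
  ext x
  rw [Set.mem_smul_set_iff_inv_smul_mem]
  simp [Units.smul_def, hu]

/-- The Haar modulus of a discretely valued field is its absolute value as soon as the two agree
at a uniformizer. -/
lemma distribHaarChar_eq_nnnorm [SecondCountableTopology F] (μ : Measure F) [μ.IsAddHaarMeasure]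
    (hμ : μ (Metric.closedBall (0 : F) 1) ≠ ∞) (t : Fˣ)
    (ht : distribHaarChar F t = ‖(t : F)‖₊) (hval : ∀ x : F, x ≠ 0 → ∃ m : ℤ, ‖x‖ = ‖(t : F)‖ ^ m)
    (u : Fˣ) : distribHaarChar F u = ‖(u : F)‖₊ := by
  obtain ⟨m, hm⟩ := hval u u.ne_zero
  have hm' : ‖(u : F)‖₊ = ‖(t : F)‖₊ ^ m := by ext; simpa using hm
  have h1 : distribHaarChar F (u * (t ^ m)⁻¹) = 1 := by
    refine distribHaarChar_of_norm_eq_one μ hμ _ ?_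
    rw [Units.val_mul, norm_mul, hm, Units.val_inv_eq_inv_val, Units.val_zpow_eq_zpow_val, norm_inv,
      norm_zpow]
    exact mul_inv_cancel₀ (zpow_ne_zero _ (norm_ne_zero_iff.2 t.ne_zero))
  rw [map_mul, map_inv, map_zpow, ht, ← hm'] at h1
  exact eq_of_mul_inv_eq_one h1

lemma measure_one_add_ball [SecondCountableTopology F] (μ : Measure F) [μ.IsAddHaarMeasure]
    (u : Fˣ) : μ {x | ‖x - 1‖ ≤ ‖(u : F)‖} =
      distribHaarChar F u * μ (Metric.closedBall (0 : F) 1) := by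
  rw [distribHaarChar_mul, ← measure_preimage_add μ (1 : F)]
  congr 1
  ext x
  have hu : 0 < ‖(u : F)‖ := norm_pos_iff.2 u.ne_zero
  rw [Set.mem_preimage, Set.mem_smul_set_iff_inv_smul_mem]
  simp [Units.smul_def, inv_mul_le_one₀ hu]

end Scaling

section PrincipalUnits

variable {F : Type*} [NormedField F] [IsUltrametricDist F] {c : ℝ}

lemma norm_eq_one_of_norm_sub_one_le (hc : c < 1) {x : F} (hx : ‖x - 1‖ ≤ c) : ‖x‖ = 1 := by
  have h := IsUltrametricDist.norm_add_eq_max_of_norm_ne_norm (x := x - 1) (y := 1)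
    (by rw [norm_one]; exact (hx.trans_lt hc).ne)
  rwa [sub_add_cancel, norm_one, max_eq_right (hx.trans hc.le)] at h

lemma norm_mul_sub_one_le (hc : c < 1) {x y : F} (hx : ‖x - 1‖ ≤ c) (hy : ‖y - 1‖ ≤ c) :
    ‖x * y - 1‖ ≤ c := by
  have h : x * y - 1 = x * (y - 1) + (x - 1) := by ring
  rw [h]
  refine (IsUltrametricDist.norm_add_le_max _ _).trans (max_le ?_ hx)
  rwa [norm_mul, norm_eq_one_of_norm_sub_one_le hc hx, one_mul]

lemma norm_inv_sub_one_le (hc : c < 1) {x : F} (hx : ‖x - 1‖ ≤ c) : ‖x⁻¹ - 1‖ ≤ c := by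
  have hx1 := norm_eq_one_of_norm_sub_one_le hc hx
  have hx0 : x ≠ 0 := norm_pos_iff.1 (by rw [hx1]; exact one_pos)
  have h : x⁻¹ - 1 = -(x⁻¹ * (x - 1)) := by field_simp; ring
  rwa [h, norm_neg, norm_mul, norm_inv, hx1, inv_one, one_mul]

end PrincipalUnits

section Padic

variable {p : ℕ} [Fact p.Prime]

lemma padicUnit_ne_zero (p : ℕ) [Fact p.Prime] : (p : ℚ_[p]) ≠ 0 :=
  Nat.cast_ne_zero.2 (Fact.out : p.Prime).ne_zero

lemma mem_smul_closedBall_iff {x : ℚ_[p]} :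
    x ∈ Units.mk0 (p : ℚ_[p]) (padicUnit_ne_zero p) • Metric.closedBall (0 : ℚ_[p]) 1 ↔ ‖x‖ < 1 := by
  have hp : (0 : ℝ) < p := Nat.cast_pos.2 (Fact.out : p.Prime).pos
  rw [Set.mem_smul_set_iff_inv_smul_mem]
  have h := Padic.norm_lt_pow_iff_norm_le_pow_sub_one x 0
  simp only [zpow_zero, zero_sub, zpow_neg_one] at h
  rw [h, ← one_div (p : ℝ), le_div_iff₀ hp, mul_comm]
  simp [Units.smul_def]

lemma sub_natCast_mem_maximalIdeal_iff (z : ℤ_[p]) (i : ℕ) :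
    z - i ∈ IsLocalRing.maximalIdeal ℤ_[p] ↔ ‖-(i : ℚ_[p]) + z‖ < 1 := by
  rw [IsLocalRing.mem_maximalIdeal, PadicInt.mem_nonunits, PadicInt.norm_def, PadicInt.coe_sub,
    PadicInt.coe_natCast, ← neg_add_eq_sub]

lemma closedBall_one_eq_iUnion :
    Metric.closedBall (0 : ℚ_[p]) 1 = ⋃ i ∈ Finset.range p,
      (fun x => (i : ℚ_[p]) + x) ''
        (Units.mk0 (p : ℚ_[p]) (padicUnit_ne_zero p) • Metric.closedBall (0 : ℚ_[p]) 1) := by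
  ext x
  simp only [Set.mem_iUnion, Set.image_add_left, Set.mem_preimage, mem_smul_closedBall_iff,
    mem_closedBall_zero_iff, Finset.mem_range, exists_prop]
  constructor
  · intro hx
    obtain ⟨z, rfl⟩ : ∃ z : ℤ_[p], (z : ℚ_[p]) = x := ⟨⟨x, hx⟩, rfl⟩
    obtain ⟨i, hi, h⟩ := PadicInt.exists_mem_range z
    exact ⟨i, hi, (sub_natCast_mem_maximalIdeal_iff z i).1 h⟩
  · rintro ⟨i, -, h⟩
    have := IsUltrametricDist.norm_add_le_max (i : ℚ_[p]) (-i + x)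
    rw [add_neg_cancel_left] at this
    refine this.trans (max_le ?_ h.le)
    exact IsUltrametricDist.norm_natCast_le_one ℚ_[p] i

variable [MeasurableSpace ℚ_[p]] [BorelSpace ℚ_[p]]

lemma measure_smul_closedBall (μ : Measure ℚ_[p]) [μ.IsAddHaarMeasure] :
    μ (Metric.closedBall (0 : ℚ_[p]) 1) = p *
      μ (Units.mk0 (p : ℚ_[p]) (padicUnit_ne_zero p) • Metric.closedBall (0 : ℚ_[p]) 1) := by
  conv_lhs => rw [closedBall_one_eq_iUnion]
  rw [measure_biUnion_finset]
  · simp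
  · intro i hi j hj hij
    refine Set.disjoint_left.2 fun x hxi hxj => hij ?_
    simp only [Set.image_add_left, Set.mem_preimage, mem_smul_closedBall_iff] at hxi hxj
    have hx : ‖x‖ ≤ 1 := by
      have : x ∈ Metric.closedBall (0 : ℚ_[p]) 1 := by
        rw [closedBall_one_eq_iUnion]
        simp only [Set.mem_iUnion, Set.image_add_left, Set.mem_preimage, mem_smul_closedBall_iff]
        exact ⟨i, hi, hxi⟩
      simpa using this
    obtain ⟨z, rfl⟩ : ∃ z : ℤ_[p], (z : ℚ_[p]) = x := ⟨⟨x, hx⟩, rfl⟩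
    exact (PadicInt.existsUnique_mem_range z).unique
      ⟨Finset.mem_range.1 hi, (sub_natCast_mem_maximalIdeal_iff z i).2 hxi⟩
      ⟨Finset.mem_range.1 hj, (sub_natCast_mem_maximalIdeal_iff z j).2 hxj⟩
  · intro i hi
    rw [Set.image_add_left]
    refine measurable_const_add _ ?_
    have : Units.mk0 (p : ℚ_[p]) (padicUnit_ne_zero p) • Metric.closedBall (0 : ℚ_[p]) 1 =
      Metric.ball 0 1 := by
        ext x
        rw [mem_smul_closedBall_iff, mem_ball_zero_iff]
    rw [this]
    exact Metric.isOpen_ball.measurableSet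

lemma distribHaarChar_padic (u : ℚ_[p]ˣ) : distribHaarChar ℚ_[p] u = ‖(u : ℚ_[p])‖₊ := by
  have hfin : Measure.addHaar (Metric.closedBall (0 : ℚ_[p]) 1) ≠ ∞ :=
    measure_closedBall_lt_top.ne
  refine distribHaarChar_eq_nnnorm Measure.addHaar hfin
    (Units.mk0 (p : ℚ_[p]) (padicUnit_ne_zero p)) ?_ ?_ u
  · refine distribHaarChar_eq_of_measure_smul_eq_mul (μ := Measure.addHaar)
      (Metric.measure_closedBall_pos _ 0 one_pos).ne' hfin ?_
    rw [measure_smul_closedBall, ← mul_assoc]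
    have : ((‖(p : ℚ_[p])‖₊ : ℝ≥0) : ℝ≥0∞) * p = 1 := by
      have h : ‖(p : ℚ_[p])‖₊ = (p : ℝ≥0)⁻¹ := by ext; simp
      rw [h, ENNReal.coe_inv (by simpa using (Fact.out : p.Prime).ne_zero)]
      exact ENNReal.inv_mul_cancel (by simpa using (Fact.out : p.Prime).ne_zero) (by simp)
    simp [this]
  · intro x hx
    refine ⟨x.valuation, ?_⟩
    rw [Padic.norm_eq_zpow_neg_valuation hx]
    simp

end Padic

section Unramified

variable {p n : ℕ} [Fact p.Prime] {K : Type} [NormedField K] [Algebra ℚ_[p] K]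

lemma IsUnramifiedDeg.norm_algebraMap (hK : IsUnramifiedDeg p n K) (x : ℚ_[p]) :
    ‖algebraMap ℚ_[p] K x‖ = ‖x‖ ^ n := by
  rw [hK.2.1, Algebra.norm_algebraMap, hK.1, norm_pow]

lemma IsUnramifiedDeg.norm_natCast (hK : IsUnramifiedDeg p n K) : ‖(p : K)‖ = ((p : ℝ) ^ n)⁻¹ := by
  rw [← map_natCast (algebraMap ℚ_[p] K), hK.norm_algebraMap, Padic.norm_p, inv_pow]

lemma IsUnramifiedDeg.isUltrametricDist (hK : IsUnramifiedDeg p n K) : IsUltrametricDist K := by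
  refine IsUltrametricDist.isUltrametricDist_of_forall_norm_natCast_le_one fun m => ?_
  rw [← map_natCast (algebraMap ℚ_[p] K), hK.norm_algebraMap]
  exact pow_le_one₀ (norm_nonneg _) (IsUltrametricDist.norm_natCast_le_one ℚ_[p] m)

lemma IsUnramifiedDeg.continuous_algebraMap (hK : IsUnramifiedDeg p n K) (hn : 0 < n) :
    Continuous (algebraMap ℚ_[p] K) := by
  refine continuous_of_continuousAt_zero (algebraMap ℚ_[p] K) ?_
  rw [ContinuousAt, map_zero, tendsto_zero_iff_norm_tendsto_zero]
  simp_rw [hK.norm_algebraMap]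
  have : Continuous fun x : ℚ_[p] => ‖x‖ ^ n := by fun_prop
  simpa [hn.ne'] using this.tendsto 0

lemma IsUnramifiedDeg.continuousSMul (hK : IsUnramifiedDeg p n K) (hn : 0 < n) :
    ContinuousSMul ℚ_[p] K :=
  ⟨by
    simp_rw [Algebra.smul_def]
    exact ((hK.continuous_algebraMap hn).comp continuous_fst).mul continuous_snd⟩

variable [FiniteDimensional ℚ_[p] K]

lemma IsUnramifiedDeg.nonempty_continuousLinearEquiv (hK : IsUnramifiedDeg p n K) (hn : 0 < n) :
    Nonempty (K ≃L[ℚ_[p]] (Fin n → ℚ_[p])) := by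
  have := hK.continuousSMul hn
  exact ⟨ContinuousLinearEquiv.ofFinrankEq (by simp [hK.1])⟩

lemma IsUnramifiedDeg.secondCountableTopology (hK : IsUnramifiedDeg p n K) (hn : 0 < n) :
    SecondCountableTopology K :=
  (hK.nonempty_continuousLinearEquiv hn).some.toHomeomorph.secondCountableTopology

lemma IsUnramifiedDeg.locallyCompactSpace (hK : IsUnramifiedDeg p n K) (hn : 0 < n) :
    LocallyCompactSpace K :=
  (hK.nonempty_continuousLinearEquiv hn).some.toHomeomorph.isClosedEmbedding.locallyCompactSpace

variable [MeasurableSpace K] [BorelSpace K]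

lemma IsUnramifiedDeg.distribHaarChar_natCast (hK : IsUnramifiedDeg p n K) (hn : 0 < n)
    [LocallyCompactSpace K] (u : Kˣ) (hu : (u : K) = p) :
    distribHaarChar K u = ‖(u : K)‖₊ := by
  have := hK.secondCountableTopology hn
  borelize ℚ_[p]
  obtain ⟨e⟩ := hK.nonempty_continuousLinearEquiv hn
  set t : ℚ_[p]ˣ := Units.mk0 (p : ℚ_[p]) (padicUnit_ne_zero p) with ht
  set B : Set ℚ_[p] := Metric.closedBall 0 1
  have hB0 : (Measure.addHaar : Measure ℚ_[p]) B ≠ 0 :=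
    (Metric.measure_closedBall_pos _ 0 one_pos).ne'
  have hBtop : (Measure.addHaar : Measure ℚ_[p]) B ≠ ∞ := measure_closedBall_lt_top.ne
  let m : Measure (Fin n → ℚ_[p]) := Measure.pi fun _ => Measure.addHaar
  have hmap : ∀ s : Set (Fin n → ℚ_[p]), Measure.map e.symm m (e ⁻¹' s) = m s := fun s => by
    have := e.symm.toHomeomorph.toMeasurableEquiv.map_apply (μ := m) (e ⁻¹' s)
    refine this.trans (congrArg m ?_)
    ext x
    change e (e.symm x) ∈ s ↔ x ∈ s
    rw [e.apply_symm_apply]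
  refine distribHaarChar_eq_of_measure_smul_eq_mul (μ := Measure.map e.symm m)
    (s := e ⁻¹' Set.univ.pi fun _ => B) ?_ ?_ ?_
  · rw [hmap, Measure.pi_pi]
    simp [hB0]
  · rw [hmap, Measure.pi_pi]
    exact ENNReal.prod_ne_top fun _ _ => hBtop
  · have hs : u • (e ⁻¹' Set.univ.pi fun _ => B) = e ⁻¹' Set.univ.pi fun _ => t • B := by
      ext x
      rw [Set.mem_smul_set_iff_inv_smul_mem]
      have hx : u⁻¹ • x = (t⁻¹ : ℚ_[p]ˣ) • x := by
        rw [inv_smul_eq_iff, Units.smul_def, hu, Units.smul_def, smul_eq_mul, Algebra.smul_def,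
          ← map_natCast (algebraMap ℚ_[p] K), ← mul_assoc, ← map_mul]
        simp [ht, padicUnit_ne_zero p]
      simp only [Set.mem_preimage, Set.mem_pi, Set.mem_univ, true_imp_iff, hx,
        Set.mem_smul_set_iff_inv_smul_mem]
      simp [Units.smul_def]
    rw [hs, hmap, hmap, Measure.pi_pi, Measure.pi_pi]
    simp_rw [← distribHaarChar_mul (Measure.addHaar : Measure ℚ_[p]) t B, distribHaarChar_padic]
    rw [Finset.prod_mul_distrib, Finset.prod_const, Finset.card_univ, Fintype.card_fin]
    congr 1
    rw [← ENNReal.coe_pow]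
    congr 1
    ext
    simp [hu, hK.norm_natCast, ht]

lemma IsUnramifiedDeg.distribHaarChar_eq (hK : IsUnramifiedDeg p n K) (hn : 0 < n)
    [LocallyCompactSpace K] (μ : Measure K) [μ.IsAddHaarMeasure] (hμ : μ (ringO K) = 1) (u : Kˣ) :
    distribHaarChar K u = ‖(u : K)‖₊ := by
  have := hK.secondCountableTopology hn
  have hp0 : (p : K) ≠ 0 := by
    rw [← map_natCast (algebraMap ℚ_[p] K), Ne, map_eq_zero]
    exact padicUnit_ne_zero p
  refine distribHaarChar_eq_nnnorm μ ?_ (Units.mk0 (p : K) hp0)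
    (hK.distribHaarChar_natCast hn _ rfl) (fun x hx => ?_) u
  · have : Metric.closedBall (0 : K) 1 = ringO K := by ext; simp [ringO]
    simp [this, hμ]
  · obtain ⟨m, hm⟩ := hK.2.2 x hx
    refine ⟨-m, ?_⟩
    rw [hm, Units.val_mk0, hK.norm_natCast, inv_zpow', neg_neg, zpow_mul, zpow_natCast]

end Unramified

section RadialGroup

variable {p : ℕ} [Fact p.Prime]

lemma inv_prime_lt_one (p : ℕ) [Fact p.Prime] : (p : ℝ)⁻¹ < 1 :=
  inv_lt_one_of_one_lt₀ (Nat.one_lt_cast.2 (Fact.out : p.Prime).one_lt)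

lemma Qp1_ne_zero {x : ℚ_[p]} (hx : x ∈ Qp1 p) : x ≠ 0 := by
  obtain ⟨k, u, hu, rfl⟩ := hx
  have hu1 := norm_eq_one_of_norm_sub_one_le (inv_prime_lt_one p) hu
  exact mul_ne_zero (zpow_ne_zero _ (padicUnit_ne_zero p))
    (norm_pos_iff.1 (by rw [hu1]; exact one_pos))

lemma Qp1_mul {x y : ℚ_[p]} (hx : x ∈ Qp1 p) (hy : y ∈ Qp1 p) : x * y ∈ Qp1 p := by
  obtain ⟨k, u, hu, rfl⟩ := hx
  obtain ⟨l, v, hv, rfl⟩ := hy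
  refine ⟨k + l, u * v, norm_mul_sub_one_le (inv_prime_lt_one p) hu hv, ?_⟩
  rw [zpow_add₀ (padicUnit_ne_zero p)]
  ring

lemma Qp1_inv {x : ℚ_[p]} (hx : x ∈ Qp1 p) : x⁻¹ ∈ Qp1 p := by
  obtain ⟨k, u, hu, rfl⟩ := hx
  exact ⟨-k, u⁻¹, norm_inv_sub_one_le (inv_prime_lt_one p) hu, by rw [mul_inv, zpow_neg]⟩

lemma Qp1_mul_mem_iff {x y : ℚ_[p]} (hx : x ∈ Qp1 p) : x * y ∈ Qp1 p ↔ y ∈ Qp1 p :=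
  ⟨fun h => by simpa [Qp1_ne_zero hx] using Qp1_mul (Qp1_inv hx) h, Qp1_mul hx⟩

lemma PUnits1_subset_Qp1 : PUnits1 p ⊆ Qp1 p := fun u hu => ⟨0, u, hu, by simp⟩

variable [MeasurableSpace ℚ_[p]] [BorelSpace ℚ_[p]]

lemma measurableSet_PUnits1 : MeasurableSet (PUnits1 p) :=
  (isClosed_le (by fun_prop) continuous_const).measurableSet

lemma measurableSet_Qp1 : MeasurableSet (Qp1 p) := by
  have h : Qp1 p = ⋃ k : ℤ, (fun x => ((p : ℚ_[p]) ^ k)⁻¹ * x) ⁻¹' PUnits1 p := by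
    ext x
    simp only [Set.mem_iUnion, Set.mem_preimage]
    refine exists_congr fun k => ⟨?_, fun h => ⟨_, h, ?_⟩⟩
    · rintro ⟨u, hu, rfl⟩
      rwa [inv_mul_cancel_left₀ (zpow_ne_zero _ (padicUnit_ne_zero p))]
    · rw [mul_inv_cancel_left₀ (zpow_ne_zero _ (padicUnit_ne_zero p))]
  rw [h]
  exact MeasurableSet.iUnion fun k => measurableSet_PUnits1.preimage (by fun_prop)

lemma measure_PUnits1 (μ : Measure ℚ_[p]) [μ.IsAddHaarMeasure]
    (hμ : μ {z : ℚ_[p] | ‖z‖ ≤ 1} = 1) : μ (PUnits1 p) = ((p : ℝ≥0)⁻¹ : ℝ≥0) := by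
  have h := measure_one_add_ball μ (Units.mk0 (p : ℚ_[p]) (padicUnit_ne_zero p))
  have hB : Metric.closedBall (0 : ℚ_[p]) 1 = {z : ℚ_[p] | ‖z‖ ≤ 1} := by ext; simp
  rw [hB, hμ, mul_one, distribHaarChar_padic] at h
  simp only [Units.val_mk0, Padic.norm_p] at h
  rw [PUnits1, h]
  congr 1
  ext
  simp

lemma lintegral_Qp1_mul (μ : Measure ℚ_[p]) [μ.IsAddHaarMeasure] {n : ℕ} (hn : 0 < n)
    {x : ℚ_[p]} (hx : x ∈ Qp1 p) {h : ℚ_[p] → ℝ≥0∞} (hh : Measurable h) :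
    ‖x‖ₑ ^ n * ∫⁻ y in Qp1 p, ‖y‖ₑ ^ (n - 1) * h (x * y) ∂μ =
      ∫⁻ y in Qp1 p, ‖y‖ₑ ^ (n - 1) * h y ∂μ := by
  have hm : Measurable ((Qp1 p).indicator fun y => ‖y‖ₑ ^ (n - 1) * h y) :=
    Measurable.indicator (by fun_prop) measurableSet_Qp1
  rw [← lintegral_indicator measurableSet_Qp1, ← lintegral_indicator measurableSet_Qp1,
    ← distribHaarChar_mul_lintegral μ (Units.mk0 x (Qp1_ne_zero hx)) hm, distribHaarChar_padic,
    Units.val_mk0, ← enorm_eq_nnnorm]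
  have hpow : ‖x‖ₑ ^ n = ‖x‖ₑ * ‖x‖ₑ ^ (n - 1) := by rw [mul_comm, pow_sub_one_mul hn.ne']
  rw [hpow, mul_assoc, ← lintegral_const_mul' _ _ (ENNReal.pow_ne_top enorm_ne_top)]
  congr 1
  refine lintegral_congr fun y => ?_
  by_cases hy : y ∈ Qp1 p
  · rw [Set.indicator_of_mem hy, Set.indicator_of_mem (Qp1_mul hx hy), enorm_mul, mul_pow, mul_assoc]
  · rw [Set.indicator_of_notMem hy, Set.indicator_of_notMem (fun h => hy ((Qp1_mul_mem_iff hx).1 h)),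
      mul_zero]

end RadialGroup

section Decomposition

variable {p n q : ℕ} {K : Type} [NormedField K] {ω : K → K}

lemma muRoots_one : (1 : K) ∈ muRoots q K := one_pow _

lemma muRoots_mul {v w : K} (hv : v ∈ muRoots q K) (hw : w ∈ muRoots q K) : v * w ∈ muRoots q K := by
  rw [muRoots, Set.mem_ofPred_eq] at *
  rw [mul_pow, hv, hw, one_mul]

lemma muRoots_inv {w : K} (hw : w ∈ muRoots q K) : w⁻¹ ∈ muRoots q K := by
  rw [muRoots, Set.mem_ofPred_eq] at *
  rw [inv_pow, hw, inv_one]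

lemma muRoots_ne_zero (hq : 1 < q) {w : K} (hw : w ∈ muRoots q K) : w ≠ 0 := by
  rintro rfl
  rw [muRoots, Set.mem_ofPred_eq, zero_pow (Nat.sub_pos_of_lt hq).ne'] at hw
  exact zero_ne_one hw

lemma muRoots_norm (hq : 1 < q) {w : K} (hw : w ∈ muRoots q K) : ‖w‖ = 1 := by
  have h : ‖w‖ ^ (q - 1) = 1 := by rw [← norm_pow, show w ^ (q - 1) = 1 from hw, norm_one]
  exact (pow_eq_one_iff_of_nonneg (norm_nonneg _) (Nat.sub_pos_of_lt hq).ne').1 h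

lemma muRoots_finite (hq : 1 < q) : (muRoots q K).Finite := by
  refine (Polynomial.nthRoots (q - 1) (1 : K)).toFinset.finite_toSet.subset fun w hw => ?_
  simpa [Polynomial.mem_nthRoots (Nat.sub_pos_of_lt hq), muRoots] using hw


lemma IsTeich.eq_of_eq_mul (hω : IsTeich p q K ω) {x w u : K} {k : ℤ} (hx : x ≠ 0)
    (hw : w ∈ muRoots q K) (hu : u ∈ U1 p K) (h : x = (p : K) ^ k * (w * u)) : w = ω x :=
  (hω x hx).2 w k u hw hu h

variable [Fact p.Prime] [Algebra ℚ_[p] K]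

lemma natCast_ne_zero_of_algebra (p : ℕ) [Fact p.Prime] (K : Type) [NormedField K]
    [Algebra ℚ_[p] K] : (p : K) ≠ 0 := by
  rw [← map_natCast (algebraMap ℚ_[p] K), Ne, map_eq_zero]
  exact padicUnit_ne_zero p

lemma mem_U1_iff {x : K} : x ∈ U1 p K ↔ ‖x - 1‖ ≤ ‖(p : K)‖ := by
  have hp := natCast_ne_zero_of_algebra p K
  constructor
  · rintro ⟨y, hy, rfl⟩
    rw [add_sub_cancel_left, norm_mul]
    exact mul_le_of_le_one_right (norm_nonneg _) hy
  · intro h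
    refine ⟨(x - 1) / p, ?_, by field_simp; ring⟩
    rw [ringO, Set.mem_ofPred_eq, norm_div]
    exact div_le_one_of_le₀ h (norm_nonneg _)

lemma IsUnramifiedDeg.norm_natCast_lt_one (hK : IsUnramifiedDeg p n K) (hn : 0 < n) :
    ‖(p : K)‖ < 1 := by
  rw [hK.norm_natCast]
  exact inv_lt_one_of_one_lt₀
    (one_lt_pow₀ (Nat.one_lt_cast.2 (Fact.out : p.Prime).one_lt) hn.ne')

lemma IsUnramifiedDeg.norm_eq_one_of_mem_U1 (hK : IsUnramifiedDeg p n K) (hn : 0 < n) {x : K}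
    (hx : x ∈ U1 p K) : ‖x‖ = 1 := by
  have := hK.isUltrametricDist
  exact norm_eq_one_of_norm_sub_one_le (hK.norm_natCast_lt_one hn) (mem_U1_iff.1 hx)

lemma IsUnramifiedDeg.U1_mul (hK : IsUnramifiedDeg p n K) (hn : 0 < n) {x y : K}
    (hx : x ∈ U1 p K) (hy : y ∈ U1 p K) : x * y ∈ U1 p K := by
  have := hK.isUltrametricDist
  rw [mem_U1_iff] at *
  exact norm_mul_sub_one_le (hK.norm_natCast_lt_one hn) hx hy

lemma IsUnramifiedDeg.U1_inv (hK : IsUnramifiedDeg p n K) (hn : 0 < n) {x : K}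
    (hx : x ∈ U1 p K) : x⁻¹ ∈ U1 p K := by
  have := hK.isUltrametricDist
  rw [mem_U1_iff] at *
  exact norm_inv_sub_one_le (hK.norm_natCast_lt_one hn) hx

lemma IsUnramifiedDeg.algebraMap_mem_U1 (hK : IsUnramifiedDeg p n K) {x : ℚ_[p]}
    (hx : x ∈ PUnits1 p) : algebraMap ℚ_[p] K x ∈ U1 p K := by
  rw [mem_U1_iff, ← map_one (algebraMap ℚ_[p] K), ← map_sub, hK.norm_algebraMap, hK.norm_natCast,
    ← inv_pow]
  exact pow_le_pow_left₀ (norm_nonneg _) hx n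

lemma IsUnramifiedDeg.zpow_eq_zero (hK : IsUnramifiedDeg p n K) (hn : 0 < n) {k : ℤ}
    (hk : ‖(p : K)‖ ^ k = 1) : k = 0 :=
  (zpow_eq_one_iff_right₀ (norm_nonneg _) (hK.norm_natCast_lt_one hn).ne).1 hk

lemma IsUnramifiedDeg.SigmaN_subset_U1 (hK : IsUnramifiedDeg p n K) (hn : 0 < n)
    (hω : IsTeich p q K ω) : SigmaN p K ω ⊆ U1 p K := by
  rintro x ⟨hx0, hx, hN⟩
  obtain ⟨-, k, u, hu, h⟩ := (hω x hx0).1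
  rw [hx, one_mul] at h
  have hn1 : ‖x‖ = 1 := by rw [hK.2.1, hN, norm_one]
  rw [h, norm_mul, norm_zpow, hK.norm_eq_one_of_mem_U1 hn hu, mul_one] at hn1
  rw [h, hK.zpow_eq_zero hn hn1, zpow_zero, one_mul]
  exact hu

lemma IsUnramifiedDeg.exists_spherical (hK : IsUnramifiedDeg p n K) (hn : 0 < n)
    (hω : IsTeich p q K ω) {r : K → ℚ_[p]} (hr : IsRadial p n K ω r) {x : K} (hx : x ≠ 0) :
    ∃ w ∈ muRoots q K, ∃ ξ ∈ SigmaN p K ω, ∃ ρ ∈ Qp1 p, x = w * ξ * algebraMap ℚ_[p] K ρ := by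
  obtain ⟨hw, k, u, hu, h⟩ := (hω x hx).1
  obtain ⟨hrQ, hrn⟩ := hr x hx
  have hr0 : algebraMap ℚ_[p] K (r x) ≠ 0 := (map_ne_zero _).2 (Qp1_ne_zero hrQ)
  have hw0 : ω x ≠ 0 := by
    intro h0
    rw [h0, zero_mul, mul_zero] at h
    exact hx h
  have hξ0 : (ω x)⁻¹ * x * (algebraMap ℚ_[p] K (r x))⁻¹ ≠ 0 :=
    mul_ne_zero (mul_ne_zero (inv_ne_zero hw0) hx) (inv_ne_zero hr0)
  refine ⟨ω x, hw, (ω x)⁻¹ * x * (algebraMap ℚ_[p] K (r x))⁻¹, ⟨hξ0, ?_, ?_⟩, r x, hrQ, ?_⟩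
  · obtain ⟨l, v, hv, hl⟩ := hrQ
    refine (hω.eq_of_eq_mul hξ0 (k := k - l) muRoots_one
      (hK.U1_mul hn hu (hK.U1_inv hn (hK.algebraMap_mem_U1 hv))) ?_).symm
    have hpK := natCast_ne_zero_of_algebra p K
    have h1 : (ω x)⁻¹ * x = (p : K) ^ k * u := by
      rw [inv_mul_eq_iff_eq_mul₀ hw0, mul_left_comm]
      exact h
    rw [h1, hl, map_mul, map_zpow₀, map_natCast, zpow_sub₀ hpK, mul_inv, one_mul]
    ring
  · rw [map_mul, ← hrn, ← map_inv₀, Algebra.norm_algebraMap, hK.1, inv_pow]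
    exact mul_inv_cancel₀ (pow_ne_zero _ (Qp1_ne_zero hrQ))
  · generalize ω x = w at hw0
    field_simp

lemma IsUnramifiedDeg.mul_mem_U1_iff (hK : IsUnramifiedDeg p n K) (hn : 0 < n)
    (hq : 1 < q) (hω : IsTeich p q K ω) {w ξ : K} {ρ : ℚ_[p]} (hw : w ∈ muRoots q K)
    (hξ : ξ ∈ SigmaN p K ω) (hρ : ρ ∈ Qp1 p) :
    w * ξ * algebraMap ℚ_[p] K ρ ∈ U1 p K ↔ w = 1 ∧ ρ ∈ PUnits1 p := by
  have hξU := hK.SigmaN_subset_U1 hn hω hξ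
  constructor
  · intro h
    obtain ⟨k, v, hv, rfl⟩ := hρ
    have hvU := hK.algebraMap_mem_U1 hv
    have hnorm := hK.norm_eq_one_of_mem_U1 hn h
    rw [map_mul, map_zpow₀, map_natCast] at h hnorm
    rw [norm_mul, norm_mul, norm_mul, norm_zpow, muRoots_norm hq hw,
      hK.norm_eq_one_of_mem_U1 hn hξU, hK.norm_eq_one_of_mem_U1 hn hvU, one_mul, one_mul,
      mul_one] at hnorm
    have hk := hK.zpow_eq_zero hn hnorm
    subst hk
    simp only [zpow_zero, one_mul] at h ⊢
    have h0 : w * ξ * algebraMap ℚ_[p] K v ≠ 0 :=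
      norm_pos_iff.1 (by rw [hK.norm_eq_one_of_mem_U1 hn h]; exact one_pos)
    refine ⟨?_, hv⟩
    rw [hω.eq_of_eq_mul h0 (k := 0) hw (hK.U1_mul hn hξU hvU) (by rw [zpow_zero]; ring),
      ← hω.eq_of_eq_mul h0 (k := 0) muRoots_one h (by simp)]
  · rintro ⟨rfl, h⟩
    rw [one_mul]
    exact hK.U1_mul hn hξU (hK.algebraMap_mem_U1 h)

lemma measurableSet_U1 [MeasurableSpace K] [BorelSpace K] : MeasurableSet (U1 p K) := by
  have h : U1 p K = {x | ‖x - 1‖ ≤ ‖(p : K)‖} := Set.ext fun x => mem_U1_iff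
  rw [h]
  exact (isClosed_le (by fun_prop) continuous_const).measurableSet

end Decomposition

section SphericalMeasure

variable {p n q : ℕ} [Fact p.Prime] {K : Type} [NormedField K] [Algebra ℚ_[p] K]
  [MeasurableSpace K] [MeasurableSpace ℚ_[p]]

/-- The measure `r^{n-1} dr` on `ℚ_p^{(1)}`. -/
def radialMeasure (n : ℕ) (μQ : Measure ℚ_[p]) : Measure ℚ_[p] :=
  (μQ.restrict (Qp1 p)).withDensity fun ρ => ((‖ρ‖₊ ^ (n - 1) : ℝ≥0) : ℝ≥0∞)

/-- The measure on `K` given by integration in spherical coordinates, summed over `w ∈ R`. -/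
def sphericalMeasure (n : ℕ) (R : Finset K) (μS : Measure K) (μQ : Measure ℚ_[p]) : Measure K :=
  ((p : ℝ≥0) ^ (1 - (n : ℤ))) • ∑ w ∈ R,
    (μS.prod (radialMeasure n μQ)).map fun z => w * z.1 * algebraMap ℚ_[p] K z.2

instance (n : ℕ) (μQ : Measure ℚ_[p]) [SFinite μQ] : SFinite (radialMeasure n μQ) := by
  unfold radialMeasure
  infer_instance

instance (n : ℕ) (R : Finset K) (μS : Measure K) (μQ : Measure ℚ_[p]) [SFinite μS] [SFinite μQ] :
    SFinite (sphericalMeasure n R μS μQ) := by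
  unfold sphericalMeasure
  have : SFinite (∑ w ∈ R,
      (μS.prod (radialMeasure n μQ)).map fun z => w * z.1 * algebraMap ℚ_[p] K z.2) :=
    Finset.sum_induction _ SFinite (fun _ _ _ _ => inferInstance) inferInstance
      fun _ _ => inferInstance
  infer_instance

variable [BorelSpace K] [SecondCountableTopology K] [BorelSpace ℚ_[p]]
  (μS : Measure K) (μQ : Measure ℚ_[p])

lemma measurable_spherical (hA : Continuous (algebraMap ℚ_[p] K)) (w : K) :
    Measurable fun z : K × ℚ_[p] => w * z.1 * algebraMap ℚ_[p] K z.2 := by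
  have := hA.measurable
  fun_prop

lemma measurable_lintegral_radial [SFinite μQ] (hA : Continuous (algebraMap ℚ_[p] K))
    {f : K → ℝ≥0∞} (hf : Measurable f) (w : K) : Measurable fun ξ =>
      ∫⁻ ρ in Qp1 p, ‖ρ‖ₑ ^ (n - 1) * f (w * ξ * algebraMap ℚ_[p] K ρ) ∂μQ := by
  have := hA.measurable
  exact Measurable.lintegral_prod_right' (ν := μQ.restrict (Qp1 p))
    (f := fun z : K × ℚ_[p] => ‖z.2‖ₑ ^ (n - 1) * f (w * z.1 * algebraMap ℚ_[p] K z.2))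
    (by fun_prop)

lemma lintegral_sphericalMeasure [SFinite μS] [SFinite μQ] (hA : Continuous (algebraMap ℚ_[p] K))
    (R : Finset K) {f : K → ℝ≥0∞} (hf : Measurable f) :
    ∫⁻ x, f x ∂(sphericalMeasure n R μS μQ) =
      ((p : ℝ≥0) ^ (1 - (n : ℤ)) : ℝ≥0) * ∑ w ∈ R, ∫⁻ ξ, ∫⁻ ρ in Qp1 p,
        ‖ρ‖ₑ ^ (n - 1) * f (w * ξ * algebraMap ℚ_[p] K ρ) ∂μQ ∂μS := by
  have hAm := hA.measurable
  rw [sphericalMeasure, lintegral_smul_measure, lintegral_finsetSum_measure, ENNReal.smul_def,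
    smul_eq_mul]
  congr 1
  refine Finset.sum_congr rfl fun w _ => ?_
  rw [lintegral_map hf (measurable_spherical hA w), lintegral_prod _ (by fun_prop)]
  refine lintegral_congr fun ξ => ?_
  rw [radialMeasure, lintegral_withDensity_eq_lintegral_mul _ (by fun_prop) (by fun_prop)]
  simp [enorm_eq_nnnorm]

lemma sphericalMeasure_dilation [SFinite μS] [μQ.IsAddHaarMeasure]
    (hK : IsUnramifiedDeg p n K) (hn : 0 < n) {ω : K → K}
    (hω : IsTeich p q K ω) {r : K → ℚ_[p]} (hr : IsRadial p n K ω r) (hq : 1 < q)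
    {R : Finset K} (hR : ∀ w, w ∈ R ↔ w ∈ muRoots q K)
    (hSinv : ∀ ξ₀ ∈ SigmaN p K ω, Measure.map (fun y => ξ₀ * y) μS = μS)
    {a : K} (ha : a ≠ 0) {f : K → ℝ≥0∞} (hf : Measurable f) :
    ‖a‖ₑ * ∫⁻ x, f (a * x) ∂(sphericalMeasure n R μS μQ) =
      ∫⁻ x, f x ∂(sphericalMeasure n R μS μQ) := by
  have hA := hK.continuous_algebraMap hn
  have hAm := hA.measurable
  obtain ⟨w₀, hw₀, ξ₀, hξ₀, ρ₀, hρ₀, rfl⟩ := hK.exists_spherical hn hω hr ha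
  have hw₀0 := muRoots_ne_zero hq hw₀
  have hnorm : ‖w₀ * ξ₀ * algebraMap ℚ_[p] K ρ₀‖ₑ = ‖ρ₀‖ₑ ^ n := by
    rw [enorm_mul, enorm_mul, ← ofReal_norm, ← ofReal_norm, muRoots_norm hq hw₀,
      hK.norm_eq_one_of_mem_U1 hn (hK.SigmaN_subset_U1 hn hω hξ₀), ENNReal.ofReal_one, one_mul,
      one_mul, ← ofReal_norm, hK.norm_algebraMap, ENNReal.ofReal_pow (norm_nonneg _), ofReal_norm]
  rw [hnorm, lintegral_sphericalMeasure μS μQ hA R (by fun_prop),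
    lintegral_sphericalMeasure μS μQ hA R hf, mul_left_comm, Finset.mul_sum]
  congr 1
  have key : ∀ w : K, ‖ρ₀‖ₑ ^ n * ∫⁻ ξ, ∫⁻ ρ in Qp1 p, ‖ρ‖ₑ ^ (n - 1) *
        f (w₀ * ξ₀ * algebraMap ℚ_[p] K ρ₀ * (w * ξ * algebraMap ℚ_[p] K ρ)) ∂μQ ∂μS =
      ∫⁻ ξ, ∫⁻ ρ in Qp1 p, ‖ρ‖ₑ ^ (n - 1) * f (w₀ * w * ξ * algebraMap ℚ_[p] K ρ) ∂μQ ∂μS := by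
    intro w
    rw [← lintegral_const_mul' _ _ (ENNReal.pow_ne_top enorm_ne_top)]
    conv_rhs => rw [← hSinv ξ₀ hξ₀]
    rw [lintegral_map (measurable_lintegral_radial μQ hA hf (w₀ * w)) (by fun_prop)]
    refine lintegral_congr fun ξ => ?_
    conv_rhs => rw [← lintegral_Qp1_mul μQ hn hρ₀ (by fun_prop)]
    congr 1
    refine lintegral_congr fun ρ => ?_
    rw [map_mul]
    congr 2
    ring
  simp_rw [key]
  refine Finset.sum_nbij' (fun w => w₀ * w) (fun w => w₀⁻¹ * w) ?_ ?_ ?_ ?_ ?_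
  · exact fun w hw => (hR _).2 (muRoots_mul hw₀ ((hR _).1 hw))
  · exact fun w hw => (hR _).2 (muRoots_mul (muRoots_inv hw₀) ((hR _).1 hw))
  · exact fun w _ => inv_mul_cancel_left₀ hw₀0 w
  · exact fun w _ => mul_inv_cancel_left₀ hw₀0 w
  · exact fun w _ => rfl

lemma sphericalMeasure_U1 [IsProbabilityMeasure μS] [μQ.IsAddHaarMeasure]
    (hμQ : μQ {z : ℚ_[p] | ‖z‖ ≤ 1} = 1)
    (hK : IsUnramifiedDeg p n K) (hn : 0 < n) {ω : K → K}
    (hω : IsTeich p q K ω) (hq : 1 < q)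
    {R : Finset K} (hR : ∀ w, w ∈ R ↔ w ∈ muRoots q K)
    (hS : ∀ᵐ ξ ∂μS, ξ ∈ SigmaN p K ω) :
    sphericalMeasure n R μS μQ (U1 p K) = ‖(p : K)‖ₑ := by
  have hA := hK.continuous_algebraMap hn
  have hU : MeasurableSet (U1 p K) := measurableSet_U1
  rw [← lintegral_indicator_one hU,
    lintegral_sphericalMeasure μS μQ hA R (measurable_one.indicator hU)]
  have h1 : ∀ w ∈ R, (∫⁻ ξ, ∫⁻ ρ in Qp1 p, ‖ρ‖ₑ ^ (n - 1) *
      (U1 p K).indicator 1 (w * ξ * algebraMap ℚ_[p] K ρ) ∂μQ ∂μS) =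
        if w = 1 then μQ (PUnits1 p) else 0 := by
    intro w hw
    have h2 : ∀ ξ ∈ SigmaN p K ω, (∫⁻ ρ in Qp1 p, ‖ρ‖ₑ ^ (n - 1) *
        (U1 p K).indicator 1 (w * ξ * algebraMap ℚ_[p] K ρ) ∂μQ) =
          if w = 1 then μQ (PUnits1 p) else 0 := by
      intro ξ hξ
      have h3 : ∀ ρ ∈ Qp1 p, ‖ρ‖ₑ ^ (n - 1) *
          (U1 p K).indicator (1 : K → ℝ≥0∞) (w * ξ * algebraMap ℚ_[p] K ρ) =
          if w = 1 then (PUnits1 p).indicator 1 ρ else 0 := by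
        intro ρ hρ
        have hiff := hK.mul_mem_U1_iff hn hq hω ((hR w).1 hw) hξ hρ
        by_cases h : w * ξ * algebraMap ℚ_[p] K ρ ∈ U1 p K
        · obtain ⟨hw1, hρ1⟩ := hiff.1 h
          rw [if_pos hw1, Set.indicator_of_mem h, Set.indicator_of_mem hρ1, ← ofReal_norm,
            norm_eq_one_of_norm_sub_one_le (inv_prime_lt_one p) hρ1]
          simp
        · rw [Set.indicator_of_notMem h, mul_zero]
          split_ifs with hw1
          · rw [Set.indicator_of_notMem fun h' => h (hiff.2 ⟨hw1, h'⟩)]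
          · rfl
      rw [setLIntegral_congr_fun measurableSet_Qp1 h3]
      split_ifs with hw1
      · rw [lintegral_indicator_one measurableSet_PUnits1,
          Measure.restrict_apply measurableSet_PUnits1,
          Set.inter_eq_left.2 PUnits1_subset_Qp1]
      · simp
    rw [lintegral_congr_ae (hS.mono h2), lintegral_const, measure_univ, mul_one]
  rw [Finset.sum_congr rfl h1, Finset.sum_ite_eq', if_pos ((hR 1).2 muRoots_one),
    measure_PUnits1 μQ hμQ, ← ENNReal.coe_mul, enorm_eq_nnnorm]
  congr 1
  have hp : (p : ℝ≥0) ≠ 0 := Nat.cast_ne_zero.2 (Fact.out : p.Prime).ne_zero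
  ext
  rw [coe_nnnorm, hK.norm_natCast, zpow_sub₀ hp, zpow_one, zpow_natCast]
  have hp' : (p : ℝ) ≠ 0 := Nat.cast_ne_zero.2 (Fact.out : p.Prime).ne_zero
  push_cast
  field_simp

lemma ae_ne_zero_sphericalMeasure [IsProbabilityMeasure μS] [μQ.IsAddHaarMeasure]
    (hK : IsUnramifiedDeg p n K) (hn : 0 < n) {ω : K → K} (hq : 1 < q)
    {R : Finset K} (hR : ∀ w, w ∈ R ↔ w ∈ muRoots q K) (hS : ∀ᵐ ξ ∂μS, ξ ∈ SigmaN p K ω) :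
    ∀ᵐ x ∂(sphericalMeasure n R μS μQ), x ≠ 0 := by
  have hA := hK.continuous_algebraMap hn
  have h0 : MeasurableSet ({0} : Set K) := measurableSet_singleton 0
  rw [ae_iff]
  simp only [not_not]
  change sphericalMeasure n R μS μQ {0} = 0
  rw [← lintegral_indicator_one h0,
    lintegral_sphericalMeasure μS μQ hA R (measurable_one.indicator h0),
    Finset.sum_eq_zero, mul_zero]
  intro w hw
  rw [lintegral_eq_zero_of_ae_eq_zero]
  refine hS.mono fun ξ hξ => ?_
  simp only [Pi.zero_apply]
  rw [setLIntegral_congr_fun measurableSet_Qp1 (g := fun _ => 0), lintegral_zero]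
  intro ρ hρ
  have hne : w * ξ * algebraMap ℚ_[p] K ρ ∉ ({0} : Set K) :=
    mul_ne_zero (mul_ne_zero (muRoots_ne_zero hq ((hR w).1 hw)) hξ.1)
      ((map_ne_zero _).2 (Qp1_ne_zero hρ))
  simp only
  rw [Set.indicator_of_notMem hne, mul_zero]

lemma eq_sphericalMeasure [FiniteDimensional ℚ_[p] K] [IsProbabilityMeasure μS]
    [μQ.IsAddHaarMeasure] (hμQ : μQ {z : ℚ_[p] | ‖z‖ ≤ 1} = 1)
    (μK : Measure K) [μK.IsAddHaarMeasure] (hμK : μK (ringO K) = 1)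
    (hK : IsUnramifiedDeg p n K) (hn : 0 < n) {ω : K → K}
    (hω : IsTeich p q K ω) {r : K → ℚ_[p]} (hr : IsRadial p n K ω r) (hq : 1 < q)
    {R : Finset K} (hR : ∀ w, w ∈ R ↔ w ∈ muRoots q K)
    (hS : ∀ᵐ ξ ∂μS, ξ ∈ SigmaN p K ω)
    (hSinv : ∀ ξ₀ ∈ SigmaN p K ω, Measure.map (fun y => ξ₀ * y) μS = μS) :
    μK = sphericalMeasure n R μS μQ := by
  have := hK.locallyCompactSpace hn
  have hp0 := natCast_ne_zero_of_algebra p K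
  have hpe0 : ‖(p : K)‖ₑ ≠ 0 := by simpa using hp0
  have hdil : ∀ a : K, a ≠ 0 → ∀ f : K → ℝ≥0∞, Measurable f →
      ‖a‖ₑ * ∫⁻ x, f (a * x) ∂μK = ∫⁻ x, f x ∂μK := fun a ha f hf => by
    rw [← distribHaarChar_mul_lintegral μK (Units.mk0 a ha) hf, hK.distribHaarChar_eq hn μK hμK,
      Units.val_mk0, ← enorm_eq_nnnorm]
  have hU := sphericalMeasure_U1 μS μQ hμQ hK hn hω hq hR hS
  have hUK : μK (U1 p K) = ‖(p : K)‖ₑ := by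
    have h := measure_one_add_ball μK (Units.mk0 (p : K) hp0)
    have hB : Metric.closedBall (0 : K) 1 = ringO K := by ext; simp [ringO]
    rw [hB, hμK, mul_one, hK.distribHaarChar_eq hn μK hμK, Units.val_mk0, ← enorm_eq_nnnorm] at h
    rw [← h]
    exact congrArg μK (Set.ext fun x => mem_U1_iff)
  refine measure_eq_of_dilation μK _ ?_
    (ae_ne_zero_sphericalMeasure μS μQ hK hn hq hR hS) hdil
    (fun a ha f hf => sphericalMeasure_dilation μS μQ hK hn hω hr hq hR hSinv ha hf)
    measurableSet_U1 (fun x hx => hK.norm_eq_one_of_mem_U1 hn hx) (fun x hx => hK.U1_inv hn hx)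
    (hUK.trans hU.symm) (hU ▸ hpe0) (hU ▸ enorm_ne_top)
  rw [ae_iff]
  simp only [not_not]
  change μK {0} = 0
  have h0 : MeasurableSet ({0} : Set K) := measurableSet_singleton 0
  have h := hdil p hp0 _ (measurable_one.indicator h0)
  have hind : ∀ x : K, ({0} : Set K).indicator (1 : K → ℝ≥0∞) (p * x) =
      ({0} : Set K).indicator 1 x := fun x => by simp [Set.indicator_apply, hp0]
  simp_rw [hind, lintegral_indicator_one h0] at h
  by_contra hne
  have hp1 : ‖(p : K)‖ₑ < 1 := by
    rw [← ofReal_norm, ENNReal.ofReal_lt_one]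
    exact hK.norm_natCast_lt_one hn
  refine (ENNReal.mul_lt_mul_left hne isCompact_singleton.measure_lt_top.ne hp1).ne ?_
  rw [h, one_mul]

lemma integral_sphericalMeasure [SFinite μS] [SFinite μQ] (hA : Continuous (algebraMap ℚ_[p] K))
    (R : Finset K) {f : K → ℂ} (hf : Integrable f (sphericalMeasure n R μS μQ)) :
    ∫ x, f x ∂(sphericalMeasure n R μS μQ) = (p : ℂ) ^ (1 - (n : ℤ)) * ∑ w ∈ R,
      ∫ ξ, (∫ ρ in Qp1 p, f (w * ξ * algebraMap ℚ_[p] K ρ) * ((‖ρ‖ : ℂ)) ^ (n - 1) ∂μQ) ∂μS := by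
  have hp : (p : ℝ≥0) ≠ 0 := Nat.cast_ne_zero.2 (Fact.out : p.Prime).ne_zero
  have hc := ENNReal.coe_ne_zero.2 (zpow_ne_zero (1 - (n : ℤ)) hp)
  replace hf := integrable_finsetSum_measure.1
    ((integrable_smul_measure hc ENNReal.coe_ne_top).1 hf)
  rw [sphericalMeasure, integral_smul_nnreal_measure, integral_finsetSum_measure hf,
    NNReal.smul_def, Complex.real_smul]
  congr 1
  · push_cast
    rfl
  refine Finset.sum_congr rfl fun w hw => ?_
  have hm := measurable_spherical (p := p) hA w
  have hint := hf w hw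
  rw [integral_map hm.aemeasurable hint.aestronglyMeasurable]
  refine (integral_prod _ (hint.comp_measurable hm)).trans ?_
  refine integral_congr_ae (Filter.Eventually.of_forall fun ξ => ?_)
  simp only [Function.comp_apply]
  rw [radialMeasure, integral_withDensity_eq_integral_smul (by fun_prop)]
  refine integral_congr_ae (Filter.Eventually.of_forall fun ρ => ?_)
  simp [NNReal.smul_def, mul_comm]

end SphericalMeasure

/-- Integration in spherical coordinates:
`∫_K f(x) dx = p^{1-n} Σ_{ω ∈ μ_{q-1}} ∫_{Σ_n} ∫_{ℚ_p^{(1)}} f(ωξr) |r|_p^{n-1} dr dξ`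
for every continuous compactly supported `f : K → ℂ`. -/
theorem integration_in_spherical_coordinates
    (p n q : ℕ) [Fact (Nat.Prime p)] (hp2 : p ≠ 2) (hn : 0 < n) (hpn : ¬ p ∣ n)
    (hq : q = p ^ n)
    (K : Type) [NormedField K] [Algebra ℚ_[p] K] [FiniteDimensional ℚ_[p] K]
    (hK : IsUnramifiedDeg p n K)
    (ω : K → K) (hω : IsTeich p q K ω)
    (r : K → ℚ_[p]) (hr : IsRadial p n K ω r)
    [MeasurableSpace K] [BorelSpace K]
    (μK : Measure K) [μK.IsAddHaarMeasure] (hμK : μK (ringO K) = 1)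
    [MeasurableSpace ℚ_[p]] [BorelSpace ℚ_[p]]
    (μQ : Measure ℚ_[p]) [μQ.IsAddHaarMeasure] (hμQ : μQ {z : ℚ_[p] | ‖z‖ ≤ 1} = 1)
    -- `μS` is the normalized Haar measure of the compact group `Σ_n`:
    (μS : Measure K) (hS1 : μS (SigmaN p K ω) = 1) (hS2 : μS (SigmaN p K ω)ᶜ = 0)
    (hSinv : ∀ ξ₀ ∈ SigmaN p K ω, Measure.map (fun y => ξ₀ * y) μS = μS) :
    ∀ f : K → ℂ, Continuous f → HasCompactSupport f →
      ∫ x, f x ∂μK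
        = (p : ℂ) ^ (1 - (n : ℤ)) *
          ∑ᶠ w ∈ muRoots q K,
            ∫ ξ, (∫ ρ in Qp1 p,
                f (w * ξ * algebraMap ℚ_[p] K ρ) * ((‖ρ‖ : ℂ)) ^ (n - 1) ∂μQ) ∂μS := by
  intro f hf hfc
  have hq1 : 1 < q := hq ▸ one_lt_pow₀ (Fact.out : p.Prime).one_lt hn.ne'
  have := hK.secondCountableTopology hn
  have := hK.locallyCompactSpace hn
  have hμS : IsProbabilityMeasure μS := ⟨le_antisymm
    (by
      rw [← Set.union_compl_self (SigmaN p K ω)]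
      refine (measure_union_le _ _).trans ?_
      rw [hS1, hS2, add_zero])
    (hS1 ▸ measure_mono (Set.subset_univ _))⟩
  have hfin := muRoots_finite (K := K) hq1
  have hμ := eq_sphericalMeasure μS μQ hμQ μK hμK hK hn hω hr hq1
    (R := hfin.toFinset) (fun w => hfin.mem_toFinset) hS2 hSinv
  have hint : Integrable f μK := hf.integrable_of_hasCompactSupport hfc
  rw [hμ] at hint
  rw [finsum_mem_eq_finite_toFinset_sum _ hfin, hμ,
    integral_sphericalMeasure μS μQ (hK.continuous_algebraMap hn) _ hint]
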